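/- arXiv:math/0305029 — 2 statements merged into one kernel-verified Lean document; each statement's English description precedes it below -/
import Mathlib

section
/- Suppose A, B ∈ ℤ* satisfy A ~ B, and let d = det(A) = det(B). Then there exists (x, y) ∈ ℤ² such that Sub(A) = Sub(B) + d·(x, y); consequently Subbar(A) = Subbar(B) in ℤ/dℤ × ℤ/dℤ. -/
/-- `Y` is a blowing-up of the finite integer sequence `X`. -/
inductive SeqBlowup : List ℤ → List ℤ → Prop
  | empty : SeqBlowup [] [-1]
  | left (x : ℤ) (l : List ℤ) : SeqBlowup (x :: l) (-1 :: (x - 1) :: l)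
  | mid (A B : List ℤ) (a b : ℤ) :
      SeqBlowup (A ++ a :: b :: B) (A ++ (a - 1) :: -1 :: (b - 1) :: B)
  | right (l : List ℤ) (x : ℤ) : SeqBlowup (l ++ [x]) (l ++ [x - 1, -1])

/-- Two sequences are equivalent if one is obtained from the other by a finite
sequence of blowings-up and blowings-down. -/
def SeqEquiv (X Y : List ℤ) : Prop := Relation.EqvGen SeqBlowup X Y

/-- The determinant of the matrix `-M(X)`, where `M(X)` is the intersection matrix of
the sequence `X` (diagonal `xᵢ`, `1` on the off-diagonals `|i-j| = 1`); `det(∅) = 1`. -/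
def seqDet : List ℤ → ℤ
  | [] => 1
  | [x] => -x
  | x :: y :: l => -x * seqDet (y :: l) - seqDet l

/-- `det₁(x₁,…,xₙ) = det(x₂,…,xₙ)`, with `det₁(∅) = 0`. -/
def seqDet1 : List ℤ → ℤ
  | [] => 0
  | _ :: l => seqDet l

/-- The transfer matrix of a single entry of a sequence. -/
def transferStep (a : ℤ) : Matrix (Fin 2) (Fin 2) ℤ := !![-a, -1; 1, 0]

/-- The product of the transfer matrices of the entries of a sequence. -/
def transfer (l : List ℤ) : Matrix (Fin 2) (Fin 2) ℤ := (l.map transferStep).prod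

theorem transfer_cons (a : ℤ) (l : List ℤ) :
    transfer (a :: l) = transferStep a * transfer l := by
  simp [transfer]

theorem transfer_append (l m : List ℤ) : transfer (l ++ m) = transfer l * transfer m := by
  simp [transfer]

theorem seqDet_cons (a : ℤ) (l : List ℤ) : seqDet (a :: l) = -a * seqDet l - seqDet1 l := by
  cases l <;> simp [seqDet, seqDet1]

theorem transfer_fst_col (l : List ℤ) :
    transfer l 0 0 = seqDet l ∧ transfer l 1 0 = seqDet1 l := by
  induction l with
  | nil => simp [transfer, seqDet, seqDet1]
  | cons a l ih =>
    rw [transfer_cons, seqDet_cons]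
    simp [transferStep, Matrix.mul_apply, Fin.sum_univ_two, ih.1, ih.2, seqDet1, sub_eq_add_neg]

theorem transfer_reverse (l : List ℤ) :
    transfer l.reverse =
      !![transfer l 0 0, -transfer l 1 0; -transfer l 0 1, transfer l 1 1] := by
  induction l with
  | nil => ext i j; fin_cases i <;> fin_cases j <;> simp [transfer]
  | cons a l ih =>
    rw [List.reverse_cons, transfer_append, ih, transfer_cons, transfer_cons]
    ext i j
    fin_cases i <;> fin_cases j <;>
      simp [transfer, transferStep, Matrix.mul_apply, Fin.sum_univ_two] <;> ring

theorem seqDet1_reverse (l : List ℤ) : seqDet1 l.reverse = -transfer l 0 1 := by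
  rw [← (transfer_fst_col l.reverse).2, transfer_reverse]
  simp

theorem transferStep_blowup_left (x : ℤ) :
    transferStep (-1) * transferStep (x - 1) = !![1, 0; 1, 1] * transferStep x := by
  simp [transferStep]
  constructor <;> ring

theorem transferStep_blowup_right (x : ℤ) :
    transferStep (x - 1) * transferStep (-1) = transferStep x * !![1, -1; 0, 1] := by
  simp [transferStep]
  constructor <;> ring

theorem transferStep_blowup_mid (a b : ℤ) :
    transferStep (a - 1) * (transferStep (-1) * transferStep (b - 1)) =
      transferStep a * transferStep b := by
  rw [transferStep_blowup_left]
  simp [transferStep]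
  ring

theorem SeqBlowup.transfer_modEq {X Y : List ℤ} (h : SeqBlowup X Y) :
    transfer X 0 0 = transfer Y 0 0 ∧
    transfer X 1 0 ≡ transfer Y 1 0 [ZMOD transfer X 0 0] ∧
    transfer X 0 1 ≡ transfer Y 0 1 [ZMOD transfer X 0 0] := by
  cases h with
  | empty => simp [transfer, transferStep, Int.modEq_one]
  | left x l =>
    have key : transfer (-1 :: (x - 1) :: l) = !![1, 0; 1, 1] * transfer (x :: l) := by
      rw [transfer_cons, transfer_cons, transfer_cons, ← mul_assoc, transferStep_blowup_left,
        mul_assoc]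
    rw [key]
    simp [Matrix.mul_apply, Fin.sum_univ_two, Int.modEq_iff_dvd]
  | mid A B a b =>
    have key : transfer (A ++ (a - 1) :: -1 :: (b - 1) :: B) = transfer (A ++ a :: b :: B) := by
      have := transferStep_blowup_mid a b
      simp only [transfer_append, transfer_cons]
      rw [← mul_assoc (transferStep a), ← this]
      simp only [mul_assoc]
    rw [key]
    exact ⟨rfl, rfl, rfl⟩
  | right l x =>
    have key : transfer (l ++ [x - 1, -1]) = transfer (l ++ [x]) * !![1, -1; 0, 1] := by
      have := transferStep_blowup_right x
      simp only [transfer_append, mul_assoc]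
      simp [transfer, this]
    rw [key]
    simp [Matrix.mul_apply, Fin.sum_univ_two, Int.modEq_iff_dvd]

theorem SeqEquiv.transfer_modEq {X Y : List ℤ} (h : SeqEquiv X Y) :
    transfer X 0 0 = transfer Y 0 0 ∧
    transfer X 1 0 ≡ transfer Y 1 0 [ZMOD transfer X 0 0] ∧
    transfer X 0 1 ≡ transfer Y 0 1 [ZMOD transfer X 0 0] := by
  induction h with
  | rel _ _ h => exact h.transfer_modEq
  | refl _ => exact ⟨rfl, rfl, rfl⟩
  | symm _ _ _ ih => exact ⟨ih.1.symm, ih.1 ▸ ih.2.1.symm, ih.1 ▸ ih.2.2.symm⟩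
  | trans _ _ _ _ _ ih₁ ih₂ =>
    exact ⟨ih₁.1.trans ih₂.1, ih₁.2.1.trans (ih₁.1 ▸ ih₂.2.1), ih₁.2.2.trans (ih₁.1 ▸ ih₂.2.2)⟩

/-- **Lemma.** If `A ~ B` and `d = det(A) = det(B)`, then
`Sub(A) = Sub(B) + d·(x, y)` for some `(x, y) ∈ ℤ²`; consequently
`Subbar(A) = Subbar(B)` in `ℤ/dℤ × ℤ/dℤ`. -/
theorem sub_of_seqEquiv (A B : List ℤ) (h : SeqEquiv A B) :
    (∃ x y : ℤ,
      seqDet1 A = seqDet1 B + seqDet A * x ∧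
      seqDet1 A.reverse = seqDet1 B.reverse + seqDet A * y) ∧
    seqDet1 A ≡ seqDet1 B [ZMOD seqDet A] ∧
    seqDet1 A.reverse ≡ seqDet1 B.reverse [ZMOD seqDet A] := by
  obtain ⟨-, h₁, h₂⟩ := h.transfer_modEq
  rw [(transfer_fst_col A).1] at h₁ h₂
  rw [(transfer_fst_col A).2, (transfer_fst_col B).2] at h₁
  replace h₂ := h₂.neg
  rw [← seqDet1_reverse, ← seqDet1_reverse] at h₂
  obtain ⟨x, hx⟩ := h₁.symm.dvd
  obtain ⟨y, hy⟩ := h₂.symm.dvd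
  exact ⟨⟨x, y, by linarith, by linarith⟩, h₁, h₂⟩
end

section
/- For every n ∈ ℕ and all A, B, C ∈ ℤ*: (A, B, 0^{2n}, C) ~ (A, 0^{2n}, B, C), where 0^{2n} denotes 2n copies of 0 and commas denote concatenation. -/
theorem SeqEquiv.refl (X : List ℤ) : SeqEquiv X X :=
  Relation.EqvGen.refl X

theorem SeqEquiv.trans {X Y Z : List ℤ} (h₁ : SeqEquiv X Y) (h₂ : SeqEquiv Y Z) :
    SeqEquiv X Z :=
  Relation.EqvGen.trans _ _ _ h₁ h₂

theorem SeqEquiv.symm {X Y : List ℤ} (h : SeqEquiv X Y) : SeqEquiv Y X :=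
  Relation.EqvGen.symm _ _ h

/-- One unit can be moved across an interior zero. -/
theorem seqEquiv_shift_one (A C : List ℤ) (a b : ℤ) :
    SeqEquiv (A ++ a :: 0 :: b :: C) (A ++ (a - 1) :: 0 :: (b + 1) :: C) := by
  have h₁ := SeqBlowup.mid A (b :: C) a 0
  have h₂ := SeqBlowup.mid (A ++ [a - 1]) C 0 (b + 1)
  simp only [List.append_assoc, List.singleton_append, zero_sub, add_sub_cancel_right] at h₁ h₂
  exact Relation.EqvGen.trans _ _ _ (.rel _ _ h₁) (.symm _ _ (.rel _ _ h₂))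

/-- Any integer can be moved across an interior zero. -/
theorem seqEquiv_shift (A C : List ℤ) (a b k : ℤ) :
    SeqEquiv (A ++ a :: 0 :: b :: C) (A ++ (a - k) :: 0 :: (b + k) :: C) := by
  induction k using Int.induction_on with
  | zero => simpa using SeqEquiv.refl _
  | succ k ih =>
    refine ih.trans ?_
    simpa only [sub_sub, add_assoc] using seqEquiv_shift_one A C (a - k) (b + k)
  | pred k ih =>
    refine ih.trans (SeqEquiv.symm ?_)
    simpa only [sub_sub, add_assoc, sub_add_cancel] using
      seqEquiv_shift_one A C (a - (-k - 1)) (b + (-k - 1))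

/-- A pair of zeros can be moved to the left of any block. -/
theorem seqEquiv_move_two_zeros (A B C : List ℤ) :
    SeqEquiv (A ++ B ++ 0 :: 0 :: C) (A ++ 0 :: 0 :: (B ++ C)) := by
  induction B generalizing A with
  | nil => simpa using SeqEquiv.refl _
  | cons x B ih =>
    have h₁ := ih (A ++ [x])
    have h₂ := seqEquiv_shift A (B ++ C) x 0 x
    simp only [List.append_assoc, List.cons_append, List.nil_append, sub_self, zero_add] at h₁ h₂ ⊢
    exact h₁.trans h₂

/-- **Lemma.** `(A, B, 0^{2n}, C) ~ (A, 0^{2n}, B, C)`. -/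
theorem seqEquiv_move_zeros (n : ℕ) (A B C : List ℤ) :
    SeqEquiv (A ++ B ++ List.replicate (2 * n) 0 ++ C)
      (A ++ List.replicate (2 * n) 0 ++ B ++ C) := by
  induction n generalizing A C with
  | zero => simpa using SeqEquiv.refl _
  | succ n ih =>
    have h₁ := seqEquiv_move_two_zeros A B (List.replicate (2 * n) 0 ++ C)
    have h₂ := ih (A ++ [0, 0]) C
    simp only [Nat.mul_succ, Nat.add_comm (2 * n) 2, List.replicate_add, List.append_assoc,
      List.replicate_succ, List.replicate_zero, List.cons_append, List.nil_append] at h₁ h₂ ⊢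
    exact h₁.trans h₂
end
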